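/- The mixing time of the boundary driven symmetric simple exclusion process on Ω_N = {0,1}^{{1,…,N−1}} with boundary densities 0 < α ≤ β < 1 satisfies T^mix_N ≤ N³/2 for all N. -/

import Mathlib

open MeasureTheory ENNReal Filter Topology Set

noncomputable section

/-- First hitting time (after time `0`) of a set `A` by a path `ω`, with value `∞`
if the path never visits `A`. -/
def hitTime {S : Type*} (A : Set S) (ω : NNReal → S) : ℝ≥0∞ :=
  sInf {t : ℝ≥0∞ | ∃ s : NNReal, (s : ℝ≥0∞) = t ∧ 0 < s ∧ ω s ∈ A}

/-- Return time of a set `A`: first time the path is in `A` after having moved away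
from its initial state. -/
def hitTimePlus {S : Type*} (A : Set S) (ω : NNReal → S) : ℝ≥0∞ :=
  sInf {t : ℝ≥0∞ | ∃ s : NNReal, (s : ℝ≥0∞) = t ∧ 0 < s ∧ ω s ∈ A ∧
    ∃ r : NNReal, 0 < r ∧ r < s ∧ ω r ≠ ω 0}

/-- An irreducible continuous-time Markov chain on a finite state space `S`:
jump rates `R`, path-space laws `P η` (law of the process started at `η`),
and unique stationary probability vector `ν`. -/
structure CTMC (S : Type*) [Fintype S] [MeasurableSpace S] where
  R : S → S → ℝ
  R_nonneg : ∀ η ξ, 0 ≤ R η ξ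
  R_diag : ∀ η, R η η = 0
  P : S → Measure (NNReal → S)
  P_prob : ∀ η, IsProbabilityMeasure (P η)
  P_start : ∀ η, P η {ω | ω 0 = η} = 1
  markov : ∀ (η ζ : S) (s : NNReal) (B : Set (NNReal → S)), MeasurableSet B →
    P η ({ω | ω s = ζ} ∩ {ω | (fun t => ω (s + t)) ∈ B})
      = P η {ω | ω s = ζ} * P ζ B
  jump_rate : ∀ η ξ, η ≠ ξ →
    Tendsto (fun t : NNReal => ((P η) {ω | ω t = ξ}).toReal / (t : ℝ))
      (nhdsWithin 0 (Set.Ioi 0)) (nhds (R η ξ))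
  irreducible : ∀ η ξ : S, ∃ (n : ℕ) (c : Fin (n + 1) → S),
    c 0 = η ∧ c (Fin.last n) = ξ ∧ ∀ i : Fin n, 0 < R (c i.castSucc) (c i.succ)
  ν : S → ℝ
  ν_pos : ∀ η, 0 < ν η
  ν_sum : ∑ η, ν η = 1
  stationary : ∀ (t : NNReal) (ξ : S),
    ∑ η, ν η * ((P η) {ω | ω t = ξ}).toReal = ν ξ

namespace CTMC

variable {S : Type*} [Fintype S] [MeasurableSpace S]

/-- Mass `ν(A)` of a set under the stationary measure. -/
def nuSet (c : CTMC S) (A : Set S) : ℝ := ∑ η, A.indicator c.ν η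

/-- Total jump rate `R(η, A)` from a state `η` into a set `A`. -/
def rateTo (c : CTMC S) (η : S) (A : Set S) : ℝ := ∑ ξ, A.indicator (c.R η) ξ

/-- Holding rate `λ(η)` of a state. -/
def lam (c : CTMC S) (η : S) : ℝ := ∑ ξ, c.R η ξ

/-- The average rate `r(Aᶜ, A)` at which the process jumps from `Aᶜ` to `A`. -/
def avgRate (c : CTMC S) (A : Set S) : ℝ :=
  (c.nuSet Aᶜ)⁻¹ * ∑ η, Aᶜ.indicator (fun η => c.ν η * c.rateTo η A) η

/-- Law of the process with initial distribution `μ`. -/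
def Pmu (c : CTMC S) (μ : S → ℝ) : Measure (NNReal → S) :=
  ∑ η, (ENNReal.ofReal (μ η)) • c.P η

/-- Law of the stationary process. -/
def Pnu (c : CTMC S) : Measure (NNReal → S) := c.Pmu c.ν

/-- Expectation `E_ν[H_A]` of the hitting time of `A` for the stationary process. -/
def expHitNu (c : CTMC S) (A : Set S) : ℝ :=
  (∫⁻ ω, hitTime A ω ∂ c.Pnu).toReal

/-- Transition probability `p_t(η, ξ)`. -/
def trans (c : CTMC S) (t : NNReal) (η ξ : S) : ℝ := ((c.P η) {ω | ω t = ξ}).toReal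

/-- The mixing time `T^mix = inf { t > 0 : max_η ‖P_t(η, ·) − ν‖_TV ≤ 1/4 }`. -/
def tmix (c : CTMC S) : ℝ :=
  sInf {t : ℝ | 0 < t ∧ ∀ η : S,
    (1 / 2) * ∑ ξ, |c.trans t.toNNReal η ξ - c.ν ξ| ≤ 1 / 4}

/-- Tail probability `P_ν[H_A > t]`. -/
def tailNu (c : CTMC S) (A : Set S) (t : ℝ) : ℝ :=
  (c.Pnu {ω | ENNReal.ofReal t < hitTime A ω}).toReal

/-- Tail probability `P_μ[H_A > t]`. -/
def tailMu (c : CTMC S) (μ : S → ℝ) (A : Set S) (t : ℝ) : ℝ :=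
  (c.Pmu μ {ω | ENNReal.ofReal t < hitTime A ω}).toReal

/-- Capacity `Cap(A, B) = Σ_{η ∈ A} ν(η) λ(η) P_η[H_B < H⁺_A]`. -/
def capacity (c : CTMC S) (A B : Set S) : ℝ :=
  ∑ η, A.indicator (fun η =>
    c.ν η * c.lam η * ((c.P η) {ω | hitTime B ω < hitTimePlus A ω}).toReal) η

end CTMC

end
noncomputable section

/-! ### The boundary driven symmetric simple exclusion process -/

/-- Configurations of the BDSSEP on `Λ_N = {1, …, N−1}`: the site `x = i + 1 ∈ Λ_N`
corresponds to the index `i : Fin (N-1)`. -/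
abbrev Config (N : ℕ) := Fin (N - 1) → Bool

/-- The configuration obtained by interchanging the occupation variables at `x` and `y`. -/
def swapConf {n : ℕ} (x y : Fin n) (η : Fin n → Bool) : Fin n → Bool :=
  fun z => if z = x then η y else if z = y then η x else η z

/-- The configuration obtained by flipping the occupation variable at `x`. -/
def flipConf {n : ℕ} (x : Fin n) (η : Fin n → Bool) : Fin n → Bool :=
  Function.update η x (!η x)

/-- Jump rates of the BDSSEP with boundary densities `α`, `β`: nearest-neighbour
exchanges at rate `1/2`, creation/annihilation at the left boundary site at rates
`α/2`, `(1−α)/2` and at the right boundary site at rates `β/2`, `(1−β)/2`. -/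
def bdssepR (N : ℕ) (α β : ℝ) (η ξ : Config N) : ℝ :=
  (∑ x : Fin (N - 1), ∑ y : Fin (N - 1),
    if (y : ℕ) = (x : ℕ) + 1 ∧ ξ = swapConf x y η ∧ ξ ≠ η then (1 : ℝ) / 2 else 0)
  + (∑ x : Fin (N - 1),
      if (x : ℕ) = 0 ∧ ξ = flipConf x η then (if η x then (1 - α) / 2 else α / 2) else 0)
  + (∑ x : Fin (N - 1),
      if (x : ℕ) = N - 2 ∧ ξ = flipConf x η then (if η x then (1 - β) / 2 else β / 2) else 0)

/-! ### The space `ℳ` of density profiles -/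

/-- A function `γ` is a density profile (an element of `ℳ`) if `0 ≤ γ ≤ 1` on `[0,1]`. -/
def memM (γ : ℝ → ℝ) : Prop := ∀ x ∈ Set.Icc (0 : ℝ) 1, 0 ≤ γ x ∧ γ x ≤ 1

/-- The pairing `⟨γ, G⟩ = ∫₀¹ γ(x) G(x) dx`. -/
def pairing (γ G : ℝ → ℝ) : ℝ := ∫ x in (0 : ℝ)..1, γ x * G x

/-- The distance on `ℳ` associated to a sequence `F` of continuous test functions bounded
by one: `d(γ, γ') = Σ_k 2^{-k} |⟨γ, F_k⟩ − ⟨γ', F_k⟩|`. -/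
def profDist (F : ℕ → ℝ → ℝ) (γ γ' : ℝ → ℝ) : ℝ :=
  ∑' k : ℕ, (1 / 2 : ℝ) ^ (k + 1) * |pairing γ (F k) - pairing γ' (F k)|

/-- A subset of `ℳ` is open (for the metric `d`) if around each of its points it contains
a `d`-ball of `ℳ`. -/
def dOpen (F : ℕ → ℝ → ℝ) (O : Set (ℝ → ℝ)) : Prop :=
  ∀ γ ∈ O, ∃ ε > 0, ∀ γ', memM γ' → profDist F γ γ' < ε → γ' ∈ O

/-- The closure in `ℳ` of a subset of `ℳ`, for the metric `d`. -/
def dClosure (F : ℕ → ℝ → ℝ) (O : Set (ℝ → ℝ)) : Set (ℝ → ℝ) :=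
  {γ | memM γ ∧ ∀ ε > 0, ∃ γ' ∈ O, profDist F γ γ' < ε}

/-- The interior in `ℳ` of a subset of `ℳ`, for the metric `d`. -/
def dInterior (F : ℕ → ℝ → ℝ) (B : Set (ℝ → ℝ)) : Set (ℝ → ℝ) :=
  {γ | γ ∈ B ∧ ∃ ε > 0, ∀ γ', memM γ' → profDist F γ γ' < ε → γ' ∈ B}

/-- The empirical density profile `π^N(η) ∈ ℳ` of a configuration `η`: the site
`x = i+1 ∈ Λ_N` contributes the indicator of `[x/N − 1/2N, x/N + 1/2N)`. -/
def empProfile (N : ℕ) (η : Config N) : ℝ → ℝ := fun x =>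
  ∑ i : Fin (N - 1),
    if η i = true ∧ ((i : ℕ) + 1 : ℝ) / N - 1 / (2 * N) ≤ x ∧
        x < ((i : ℕ) + 1 : ℝ) / N + 1 / (2 * N)
    then 1 else 0

/-- The stationary density profile `ρ̄_{α,β}`, the solution of `Δρ = 0`, `ρ(0) = α`,
`ρ(1) = β`. -/
def rhoBar (α β : ℝ) : ℝ → ℝ := fun x => α + (β - α) * x

end
theorem measurableSet_path_eq {S : Type*} [MeasurableSpace S] [MeasurableSingletonClass S]
    (t : NNReal) (ξ : S) : MeasurableSet {ω : NNReal → S | ω t = ξ} :=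
  (measurableSet_singleton ξ).preimage (measurable_pi_apply t)

namespace CTMC

variable {S : Type*} [Fintype S] [MeasurableSpace S]

/-- The action `P_t f` of the semigroup on functions. -/
def semigroup (c : CTMC S) (t : NNReal) (f : S → ℝ) (η : S) : ℝ := ∑ ξ, c.trans t η ξ * f ξ

theorem trans_nonneg (c : CTMC S) (t : NNReal) (η ξ : S) : 0 ≤ c.trans t η ξ :=
  ENNReal.toReal_nonneg

theorem tmix_le (c : CTMC S) {t : ℝ} (ht : 0 < t)
    (h : ∀ η, (1 / 2) * ∑ ξ, |c.trans t.toNNReal η ξ - c.ν ξ| ≤ 1 / 4) : c.tmix ≤ t :=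
  csInf_le ⟨0, fun _ hs => hs.1.le⟩ ⟨ht, h⟩

theorem trans_zero_self (c : CTMC S) (η : S) : c.trans 0 η η = 1 := by
  simp [trans, c.P_start η]

theorem sum_stationary_mul_semigroup (c : CTMC S) (t : NNReal) (f : S → ℝ) :
    ∑ η, c.ν η * c.semigroup t f η = ∑ ξ, c.ν ξ * f ξ := by
  simp only [semigroup, Finset.mul_sum, ← mul_assoc]
  rw [Finset.sum_comm]
  refine Finset.sum_congr rfl fun ξ _ => ?_
  rw [← Finset.sum_mul]
  congr 1
  exact c.stationary t ξ

/-- The generator `Σ_ξ R(η, ξ) (f(ξ) − f(η))`. -/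
def generator (c : CTMC S) (f : S → ℝ) (η : S) : ℝ := ∑ ξ, c.R η ξ * (f ξ - f η)

open Classical in
/-- The deviation of the difference quotients of the transition probabilities at time `0` from
the jump rates. -/
noncomputable def rateError (c : CTMC S) (s : NNReal) : ℝ :=
  ∑ η, ∑ ξ, if η = ξ then 0 else |c.trans s η ξ / s - c.R η ξ|

theorem tendsto_rateError (c : CTMC S) : Tendsto c.rateError (𝓝[>] 0) (𝓝 0) := by
  have h : Tendsto c.rateError (𝓝[>] 0) (𝓝 (∑ _η : S, ∑ _ξ : S, (0 : ℝ))) := by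
    refine tendsto_finsetSum _ fun η _ => tendsto_finsetSum _ fun ξ _ => ?_
    by_cases hne : η = ξ
    · simp [hne]
    · simpa [hne, trans] using ((c.jump_rate η ξ hne).sub_const (c.R η ξ)).abs
  simpa using h

variable [MeasurableSingletonClass S]

theorem sum_measure_inter_path_eq (c : CTMC S) (t : NNReal) (η : S) {B : Set (NNReal → S)}
    (hB : MeasurableSet B) :
    ∑ ξ, c.P η ({ω | ω t = ξ} ∩ B) = c.P η B := by
  rw [← measure_biUnion_finset]
  · congr 1
    ext ω
    simp
  · intro ξ _ ζ _ hne
    refine Set.disjoint_left.2 fun ω h₁ h₂ => hne ?_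
    exact h₁.1.symm.trans h₂.1
  · exact fun ξ _ => (measurableSet_path_eq t ξ).inter hB

theorem sum_trans (c : CTMC S) (t : NNReal) (η : S) : ∑ ξ, c.trans t η ξ = 1 := by
  have := c.P_prob η
  have h := c.sum_measure_inter_path_eq t η MeasurableSet.univ
  simp only [Set.inter_univ, measure_univ] at h
  simp only [trans]
  rw [← ENNReal.toReal_sum fun ξ _ => measure_ne_top _ _, h, ENNReal.toReal_one]

theorem trans_add (c : CTMC S) (s t : NNReal) (η ξ : S) :
    c.trans (s + t) η ξ = ∑ ζ, c.trans s η ζ * c.trans t ζ ξ := by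
  have := c.P_prob
  have h := c.sum_measure_inter_path_eq s η (measurableSet_path_eq (s + t) ξ)
  simp only [trans, ← ENNReal.toReal_mul]
  rw [← ENNReal.toReal_sum fun ζ _ => ENNReal.mul_ne_top (measure_ne_top _ _) (measure_ne_top _ _),
    ← h]
  congr 1
  exact Finset.sum_congr rfl fun ζ _ => c.markov η ζ s _ (measurableSet_path_eq t ξ)

theorem trans_zero_of_ne (c : CTMC S) {η ξ : S} (h : ξ ≠ η) : c.trans 0 η ξ = 0 := by
  classical
  have hs := c.sum_trans 0 η
  rw [← Finset.add_sum_erase _ _ (Finset.mem_univ η), c.trans_zero_self] at hs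
  have h0 : ∑ ζ ∈ Finset.univ.erase η, c.trans 0 η ζ = 0 := by linarith
  exact (Finset.sum_eq_zero_iff_of_nonneg fun ζ _ => c.trans_nonneg 0 η ζ).1 h0 ξ (by simp [h])

theorem semigroup_zero (c : CTMC S) (f : S → ℝ) : c.semigroup 0 f = f := by
  ext η
  rw [semigroup, Finset.sum_eq_single η, c.trans_zero_self, one_mul]
  · intro ξ _ h
    rw [c.trans_zero_of_ne h, zero_mul]
  · simp

theorem semigroup_add (c : CTMC S) (s t : NNReal) (f : S → ℝ) :
    c.semigroup (s + t) f = c.semigroup s (c.semigroup t f) := by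
  ext η
  simp only [semigroup, c.trans_add, Finset.sum_mul, Finset.mul_sum, mul_assoc]
  exact Finset.sum_comm

theorem abs_semigroup_le (c : CTMC S) (t : NNReal) {f : S → ℝ} {M : ℝ} (hf : ∀ ξ, |f ξ| ≤ M)
    (η : S) : |c.semigroup t f η| ≤ M := by
  calc |c.semigroup t f η| ≤ ∑ ξ, |c.trans t η ξ * f ξ| := Finset.abs_sum_le_sum_abs _ _
    _ ≤ ∑ ξ, c.trans t η ξ * M := by
        refine Finset.sum_le_sum fun ξ _ => ?_
        rw [abs_mul, abs_of_nonneg (c.trans_nonneg t η ξ)]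
        exact mul_le_mul_of_nonneg_left (hf ξ) (c.trans_nonneg t η ξ)
    _ = M := by rw [← Finset.sum_mul, c.sum_trans, one_mul]

theorem abs_semigroup_sub_generator_le (c : CTMC S) {s : NNReal} (hs : 0 < s) {f : S → ℝ}
    (hf : ∀ ξ, |f ξ| ≤ 1) (η : S) :
    |c.semigroup s f η - (f η + s * c.generator f η)| ≤ 2 * s * c.rateError s := by
  classical
  have hs' : (0 : ℝ) < s := hs
  have h1 : c.semigroup s f η - (f η + s * c.generator f η)
      = ∑ ξ, s * ((c.trans s η ξ / s - c.R η ξ) * (f ξ - f η)) := by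
    have : f η = ∑ ξ, c.trans s η ξ * f η := by rw [← Finset.sum_mul, c.sum_trans, one_mul]
    rw [semigroup, generator, sub_add_eq_sub_sub, Finset.mul_sum]
    nth_rewrite 1 [this]
    rw [← Finset.sum_sub_distrib, ← Finset.sum_sub_distrib]
    refine Finset.sum_congr rfl fun ξ _ => ?_
    field_simp
  rw [h1]
  calc _ ≤ ∑ ξ, |s * ((c.trans s η ξ / s - c.R η ξ) * (f ξ - f η))| :=
        Finset.abs_sum_le_sum_abs _ _
    _ ≤ ∑ ξ, 2 * s * (if η = ξ then 0 else |c.trans s η ξ / s - c.R η ξ|) := by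
        refine Finset.sum_le_sum fun ξ _ => ?_
        split_ifs with h
        · simp [h]
        · rw [abs_mul, abs_mul, abs_of_pos hs']
          have h2 : |f ξ - f η| ≤ 2 := by
            have := hf ξ
            have := hf η
            rw [abs_le] at *
            constructor <;> linarith
          have := mul_le_mul_of_nonneg_left h2 (abs_nonneg (c.trans s η ξ / s - c.R η ξ))
          nlinarith
    _ ≤ 2 * s * c.rateError s := by
        rw [← Finset.mul_sum]
        refine mul_le_mul_of_nonneg_left ?_ (by positivity)
        refine Finset.single_le_sum (f := fun η => ∑ ξ, if η = ξ then (0 : ℝ) else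
          |c.trans s η ξ / s - c.R η ξ|) (fun η _ => Finset.sum_nonneg fun ξ _ => ?_)
          (Finset.mem_univ η)
        split_ifs
        · exact le_rfl
        · exact abs_nonneg _

end CTMC

section Lipschitz

variable {ι : Type*} [DecidableEq ι]

/-- `f` varies by at most `K * h x` when the value of a configuration at `x` is modified. -/
def CoordLipschitz (h : ι → ℝ) (K : ℝ) (f : (ι → Bool) → ℝ) : Prop :=
  ∀ (σ : ι → Bool) (x : ι) (b : Bool), |f (Function.update σ x b) - f σ| ≤ K * h x

theorem CoordLipschitz.abs_sub_le [Fintype ι] {h : ι → ℝ} {K : ℝ} {f : (ι → Bool) → ℝ}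
    (hf : CoordLipschitz h K f) (σ τ : ι → Bool) : |f τ - f σ| ≤ ∑ x, K * h x := by
  suffices H : ∀ A : Finset ι, |f (A.piecewise τ σ) - f σ| ≤ ∑ x ∈ A, K * h x by
    simpa using H Finset.univ
  intro A
  induction A using Finset.induction_on with
  | empty => simp
  | insert a A ha ih =>
    rw [Finset.sum_insert ha, Finset.piecewise_insert]
    exact (_root_.abs_sub_le _ (f (A.piecewise τ σ)) _).trans (add_le_add (hf _ _ _) ih)

/-- A one-step contraction bound for a generator written as a superposition of random maps. -/
theorem CoordLipschitz.add_sum_moves {J : Type*} [Fintype J]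
    {w : J → ℝ} {T : J → (ι → Bool) → ι → Bool} {g : J → ι → ℝ} {h : ι → ℝ} {K c s : ℝ}
    {f : (ι → Bool) → ℝ} (hK : 0 ≤ K) (hs : 0 ≤ s) (hw : ∀ j, 0 ≤ w j)
    (hsw : s * ∑ j, w j ≤ 1)
    (hT : ∀ j σ x b, |f (T j (Function.update σ x b)) - f (T j σ)| ≤ K * g j x)
    (hg : ∀ x, ∑ j, w j * (g j x - h x) ≤ -c * h x) (hf : CoordLipschitz h K f) :
    CoordLipschitz h ((1 - c * s) * K)
      (fun σ => f σ + s * ∑ j, w j * (f (T j σ) - f σ)) := by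
  intro σ x b
  set τ := Function.update σ x b with hτ
  have key : f τ + s * ∑ j, w j * (f (T j τ) - f τ) - (f σ + s * ∑ j, w j * (f (T j σ) - f σ))
      = (1 - s * ∑ j, w j) * (f τ - f σ) + s * ∑ j, w j * (f (T j τ) - f (T j σ)) := by
    simp only [mul_sub, Finset.sum_sub_distrib, ← Finset.sum_mul]
    ring
  have hsum : |∑ j, w j * (f (T j τ) - f (T j σ))| ≤ ∑ j, w j * (K * g j x) := by
    refine (Finset.abs_sum_le_sum_abs _ _).trans (Finset.sum_le_sum fun j _ => ?_)
    rw [abs_mul, abs_of_nonneg (hw j)]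
    exact mul_le_mul_of_nonneg_left (hT j σ x b) (hw j)
  have hg' : ∑ j, w j * (K * g j x) ≤ K * (-c * h x) + K * h x * ∑ j, w j := by
    have := mul_le_mul_of_nonneg_left (hg x) hK
    simp only [mul_sub, Finset.sum_sub_distrib, ← Finset.sum_mul] at this
    have e : ∑ j, w j * (K * g j x) = K * ∑ j, w j * g j x := by
      rw [Finset.mul_sum]
      exact Finset.sum_congr rfl fun j _ => by ring
    rw [e]
    linarith
  simp only
  rw [key]
  calc _ ≤ |(1 - s * ∑ j, w j) * (f τ - f σ)| + |s * ∑ j, w j * (f (T j τ) - f (T j σ))| :=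
        abs_add_le _ _
    _ ≤ (1 - s * ∑ j, w j) * (K * h x) + s * (K * (-c * h x) + K * h x * ∑ j, w j) := by
        rw [abs_mul, abs_mul, abs_of_nonneg hs, abs_of_nonneg (sub_nonneg.2 hsw)]
        exact add_le_add (mul_le_mul_of_nonneg_left (hf σ x b) (sub_nonneg.2 hsw))
          (mul_le_mul_of_nonneg_left (hsum.trans hg') hs)
    _ = (1 - c * s) * K * h x := by ring

end Lipschitz

namespace CTMC

variable {ι : Type*} [Fintype ι] [DecidableEq ι]

/-- If `1 + s L` contracts the coordinatewise Lipschitz constants by `1 - a s` for small `s`,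
then the semigroup contracts them by `exp (-a t)`. -/
theorem coordLipschitz_semigroup (c : CTMC (ι → Bool)) {h : ι → ℝ} (hh : ∀ x, 1 ≤ h x)
    {a s₀ : ℝ} (hs₀ : 0 < s₀)
    (hstep : ∀ s : ℝ, 0 ≤ s → s ≤ s₀ → ∀ (K : ℝ) (f : (ι → Bool) → ℝ), 0 ≤ K →
      CoordLipschitz h K f →
      CoordLipschitz h ((1 - a * s) * K) (fun σ => f σ + s * c.generator f σ))
    {K : ℝ} (hK : 0 ≤ K) {f : (ι → Bool) → ℝ} (hf : CoordLipschitz h K f) (hf1 : ∀ σ, |f σ| ≤ 1)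
    (ha : 0 ≤ a) {t : NNReal} (ht : 0 < t) :
    CoordLipschitz h (Real.exp (-a * t) * K) (c.semigroup t f) := by
  have herr : ∀ s, 0 ≤ c.rateError s := fun s =>
    Finset.sum_nonneg fun η _ => Finset.sum_nonneg fun ξ _ => by
      split_ifs
      · exact le_rfl
      · exact abs_nonneg _
  have iter : ∀ s : NNReal, 0 < s → (s : ℝ) ≤ s₀ → ∀ k : ℕ,
      CoordLipschitz h (Real.exp (-a * (k * s)) * K + k * (4 * s * c.rateError s))
        (c.semigroup (k * s) f) := by
    intro s hs hss k
    induction k with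
    | zero => simpa [c.semigroup_zero] using hf
    | succ k ih =>
      have he : 0 ≤ 4 * s * c.rateError s := mul_nonneg (by positivity) (herr s)
      set K' := Real.exp (-a * (k * s)) * K + k * (4 * s * c.rateError s) with hK'
      have hK'0 : 0 ≤ K' := by positivity
      have e : ((k + 1 : ℕ) : NNReal) * s = s + k * s := by push_cast; ring
      rw [e, c.semigroup_add]
      set g := c.semigroup (k * s) f with hg
      have hg1 : ∀ σ, |g σ| ≤ 1 := c.abs_semigroup_le _ hf1
      have hst := hstep s s.2 hss K' g hK'0 ih
      have hcoef : (1 - a * s) * K' + 4 * s * c.rateError s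
          ≤ Real.exp (-a * ((k + 1 : ℕ) * s)) * K + (k + 1 : ℕ) * (4 * s * c.rateError s) := by
        have h1 : (1 - a * s) ≤ Real.exp (-a * s) := by
          have := Real.add_one_le_exp (-a * (s : ℝ))
          linarith
        have h2 : Real.exp (-a * s) ≤ 1 :=
          Real.exp_le_one_iff.2 (by nlinarith [mul_nonneg ha s.2])
        have h3 : Real.exp (-a * ((k + 1 : ℕ) * s))
            = Real.exp (-a * s) * Real.exp (-a * (k * s)) := by
          rw [← Real.exp_add]
          push_cast
          ring_nf
        have h4 : (0 : ℝ) ≤ k * (4 * s * c.rateError s) := by positivity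
        have h5 := mul_le_mul_of_nonneg_right h1 hK'0
        have h6 := mul_le_mul_of_nonneg_right h2 h4
        rw [h3, hK'] at *
        push_cast
        nlinarith
      intro σ x b
      have b1 := c.abs_semigroup_sub_generator_le hs hg1 (Function.update σ x b)
      have b2 := c.abs_semigroup_sub_generator_le hs hg1 σ
      have b3 := hst σ x b
      have b4 := mul_le_mul_of_nonneg_right hcoef (zero_le_one.trans (hh x))
      have b5 := mul_le_mul_of_nonneg_left (hh x) he
      rw [abs_le] at *
      constructor <;> linarith
  intro σ x b
  have hlim0 : Tendsto (fun n : ℕ => t / ((n : NNReal) + 1)) atTop (𝓝[>] 0) := by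
    refine tendsto_nhdsWithin_iff.2 ⟨?_, Eventually.of_forall fun n => ?_⟩
    · have : Tendsto (fun n : ℕ => (t : ℝ) / ((n : ℝ) + 1)) atTop (𝓝 0) :=
        tendsto_const_nhds.div_atTop
          (tendsto_atTop_add_const_right _ _ tendsto_natCast_atTop_atTop)
      rw [← NNReal.tendsto_coe]
      simpa using this
    · have : 0 < t / ((n : NNReal) + 1) := by positivity
      exact this
  have hlim : Tendsto (fun n : ℕ => (Real.exp (-a * t) * K
      + 4 * t * c.rateError (t / ((n : NNReal) + 1))) * h x) atTop
      (𝓝 ((Real.exp (-a * t) * K + 4 * t * 0) * h x)) :=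
    (((c.tendsto_rateError.comp hlim0).const_mul _).const_add _).mul_const _
  rw [mul_zero, add_zero] at hlim
  refine ge_of_tendsto hlim ?_
  have hsmall : ∀ᶠ n : ℕ in atTop, ((t / ((n : NNReal) + 1) : NNReal) : ℝ) ≤ s₀ := by
    have := (NNReal.tendsto_coe.2 (tendsto_nhdsWithin_iff.1 hlim0).1)
    exact (this.eventually_lt_const (by simpa using hs₀)).mono fun n hn => hn.le
  filter_upwards [hsmall] with n hn
  have hpos : 0 < t / ((n : NNReal) + 1) := by positivity
  have hmul : ((n + 1 : ℕ) : NNReal) * (t / ((n : NNReal) + 1)) = t := by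
    push_cast
    field_simp
  have hmul' : ((n + 1 : ℕ) : ℝ) * ((t / ((n : NNReal) + 1) : NNReal) : ℝ) = t := by
    exact_mod_cast congrArg NNReal.toReal hmul
  have hit := iter _ hpos hn (n + 1) σ x b
  rw [hmul, hmul'] at hit
  refine hit.trans (le_of_eq ?_)
  rw [← hmul']
  push_cast
  ring

/-- Total variation bound from coordinatewise Lipschitz bounds on the semigroup. -/
theorem half_sum_abs_trans_sub_le (c : CTMC (ι → Bool)) {h : ι → ℝ} {K : ℝ} (t : NNReal)
    (hL : ∀ f : (ι → Bool) → ℝ, (∀ σ, |f σ| ≤ 1 / 2) → CoordLipschitz h K (c.semigroup t f))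
    (η : ι → Bool) :
    (1 / 2) * ∑ ξ, |c.trans t η ξ - c.ν ξ| ≤ ∑ x, K * h x := by
  set f : (ι → Bool) → ℝ := fun ξ => SignType.sign (c.trans t η ξ - c.ν ξ) / 2 with hf
  have hf1 : ∀ σ, |f σ| ≤ 1 / 2 := by
    intro σ
    simp only [hf]
    rcases lt_trichotomy (c.trans t η σ - c.ν σ) 0 with h | h | h
    · simp [sign_neg h, abs_div]
    · simp [h]
    · simp [sign_pos h]
  have e1 : (1 / 2) * ∑ ξ, |c.trans t η ξ - c.ν ξ|
      = c.semigroup t f η - ∑ ζ, c.ν ζ * c.semigroup t f ζ := by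
    rw [c.sum_stationary_mul_semigroup, semigroup, ← Finset.sum_sub_distrib, Finset.mul_sum]
    refine Finset.sum_congr rfl fun ξ _ => ?_
    rw [← sign_mul_self]
    simp only [hf]
    ring
  have e2 : c.semigroup t f η = ∑ ζ, c.ν ζ * c.semigroup t f η := by
    rw [← Finset.sum_mul, c.ν_sum, one_mul]
  rw [e1, e2, ← Finset.sum_sub_distrib]
  calc _ ≤ ∑ ζ, c.ν ζ * ∑ x, K * h x := by
        refine Finset.sum_le_sum fun ζ _ => ?_
        rw [← mul_sub]
        exact mul_le_mul_of_nonneg_left ((le_abs_self _).trans ((hL f hf1).abs_sub_le ζ η))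
          (c.ν_pos ζ).le
    _ = _ := by rw [← Finset.sum_mul, c.ν_sum, one_mul]

end CTMC

section Moves

/-- The elementary moves of the BDSSEP: exchanges, and refreshments of a site from the left or
the right reservoir. -/
abbrev BdssepMove (n : ℕ) := (Fin n × Fin n) ⊕ ((Fin n × Bool) ⊕ (Fin n × Bool))

/-- The rate at which a move is performed. -/
noncomputable def bdssepWeight (N : ℕ) (α β : ℝ) : BdssepMove (N - 1) → ℝ
  | .inl p => if (p.2 : ℕ) = (p.1 : ℕ) + 1 then 1 / 2 else 0
  | .inr (.inl p) => if (p.1 : ℕ) = 0 then (if p.2 then α / 2 else (1 - α) / 2) else 0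
  | .inr (.inr p) => if (p.1 : ℕ) = N - 2 then (if p.2 then β / 2 else (1 - β) / 2) else 0

/-- The effect of a move on configurations. -/
def bdssepMap {n : ℕ} : BdssepMove n → (Fin n → Bool) → Fin n → Bool
  | .inl p, η => swapConf p.1 p.2 η
  | .inr (.inl p), η => Function.update η p.1 p.2
  | .inr (.inr p), η => Function.update η p.1 p.2

/-- The value of `h` at the position of a discrepancy after a move; it is `0` if the
discrepancy disappears. -/
def bdssepWeightAfter {n : ℕ} (h : Fin n → ℝ) : BdssepMove n → Fin n → ℝ
  | .inl p, z => h (Equiv.swap p.1 p.2 z)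
  | .inr (.inl p), z => if z = p.1 then 0 else h z
  | .inr (.inr p), z => if z = p.1 then 0 else h z

theorem swapConf_eq_comp {n : ℕ} (x y : Fin n) (η : Fin n → Bool) :
    swapConf x y η = η ∘ Equiv.swap x y := by
  ext z
  simp only [swapConf, Function.comp, Equiv.swap_apply_def]
  split_ifs <;> rfl

theorem bdssepWeight_nonneg (N : ℕ) {α β : ℝ} (hα : 0 ≤ α) (hα1 : α ≤ 1) (hβ : 0 ≤ β)
    (hβ1 : β ≤ 1) (j : BdssepMove (N - 1)) : 0 ≤ bdssepWeight N α β j := by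
  rcases j with p | p | p <;> simp only [bdssepWeight] <;> split_ifs <;> linarith

theorem abs_bdssepMap_update_sub_le {n : ℕ} {h : Fin n → ℝ} {K : ℝ}
    {f : (Fin n → Bool) → ℝ} (hf : CoordLipschitz h K f) (j : BdssepMove n) (σ : Fin n → Bool)
    (x : Fin n) (b : Bool) :
    |f (bdssepMap j (Function.update σ x b)) - f (bdssepMap j σ)|
      ≤ K * bdssepWeightAfter h j x := by
  have hupd : ∀ p : Fin n × Bool,
      |f (Function.update (Function.update σ x b) p.1 p.2) - f (Function.update σ p.1 p.2)|
        ≤ K * (if x = p.1 then 0 else h x) := by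
    intro p
    split_ifs with hx
    · simp [hx]
    · rw [Function.update_comm hx]
      exact hf _ _ _
  rcases j with p | p | p
  · simp only [bdssepMap, bdssepWeightAfter, swapConf_eq_comp, Function.update_comp_equiv,
      Equiv.symm_swap]
    exact hf _ _ _
  · exact hupd p
  · exact hupd p

theorem sum_flipRate_mul {n : ℕ} (Q : Fin n → Prop) [DecidablePred Q] (γ : ℝ)
    (f : (Fin n → Bool) → ℝ) (η : Fin n → Bool) :
    ∑ ξ, (∑ x, if Q x ∧ ξ = flipConf x η then (if η x then (1 - γ) / 2 else γ / 2) else 0)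
        * (f ξ - f η)
      = ∑ p : Fin n × Bool, (if Q p.1 then (if p.2 then γ / 2 else (1 - γ) / 2) else 0)
        * (f (Function.update η p.1 p.2) - f η) := by
  simp only [Finset.sum_mul]
  rw [Finset.sum_comm, Fintype.sum_prod_type]
  refine Finset.sum_congr rfl fun x _ => ?_
  by_cases hQ : Q x
  · simp only [hQ, true_and, ite_mul, zero_mul, Finset.sum_ite_eq', Finset.mem_univ, if_true,
      Fintype.sum_bool, flipConf]
    cases hx : η x
    · have : Function.update η x false = η := by rw [← hx, Function.update_eq_self]
      simp [this]
    · have : Function.update η x true = η := by rw [← hx, Function.update_eq_self]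
      simp [this]
  · simp [hQ]

theorem sum_bdssepR_mul (N : ℕ) (α β : ℝ) (f : Config N → ℝ) (η : Config N) :
    ∑ ξ, bdssepR N α β η ξ * (f ξ - f η)
      = ∑ j, bdssepWeight N α β j * (f (bdssepMap j η) - f η) := by
  simp only [bdssepR, add_mul, Finset.sum_add_distrib]
  rw [sum_flipRate_mul, sum_flipRate_mul, Fintype.sum_sum_type, Fintype.sum_sum_type, ← add_assoc]
  congr 2
  simp only [Finset.sum_mul]
  rw [Finset.sum_comm, Fintype.sum_prod_type]
  refine Finset.sum_congr rfl fun x _ => ?_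
  rw [Finset.sum_comm]
  refine Finset.sum_congr rfl fun y _ => ?_
  rw [Finset.sum_eq_single (swapConf x y η)]
  · by_cases hs : swapConf x y η = η
    · simp [bdssepMap, hs]
    · simp [bdssepMap, bdssepWeight, hs]
  · intro ξ _ hξ
    simp [hξ]
  · simp

/-- The mean exit time `z (N - z)` of the symmetric walk from `{1, …, N - 1}`. -/
def exitTime (N : ℕ) (i : Fin (N - 1)) : ℝ := ((i : ℝ) + 1) * (N - 1 - i)

theorem cast_add_two_le {N : ℕ} (i : Fin (N - 1)) : (i : ℝ) + 2 ≤ N := by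
  have : (i : ℕ) + 2 ≤ N := by have := i.2; omega
  exact_mod_cast this

theorem sub_one_le_exitTime {N : ℕ} (i : Fin (N - 1)) : (N : ℝ) - 1 ≤ exitTime N i := by
  have h := cast_add_two_le i
  have h0 : (0 : ℝ) ≤ i := Nat.cast_nonneg _
  rw [exitTime]
  nlinarith

theorem exitTime_le {N : ℕ} (i : Fin (N - 1)) : exitTime N i ≤ (N : ℝ) ^ 2 / 4 := by
  rw [exitTime]
  nlinarith [sq_nonneg ((N : ℝ) - 2 * (i + 1))]

theorem sum_ite_val_eq {n : ℕ} (k : ℕ) (g : Fin n → ℝ) :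
    ∑ y : Fin n, (if (y : ℕ) = k then g y else 0) = if hk : k < n then g ⟨k, hk⟩ else 0 := by
  split_ifs with hk
  · rw [Finset.sum_eq_single ⟨k, hk⟩]
    · simp
    · intro y _ hy
      rw [if_neg fun h => hy (Fin.ext h)]
    · simp
  · refine Finset.sum_eq_zero fun y _ => if_neg ?_
    have := y.2
    omega

theorem sum_refresh {n : ℕ} (k : ℕ) (γ : ℝ) (h : Fin n → ℝ) (z : Fin n) :
    ∑ p : Fin n × Bool, (if (p.1 : ℕ) = k then (if p.2 then γ / 2 else (1 - γ) / 2) else 0)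
      * ((if z = p.1 then 0 else h z) - h z) = if (z : ℕ) = k then -(h z) / 2 else 0 := by
  rw [Fintype.sum_prod_type, Finset.sum_eq_single z]
  · split_ifs
    · simp
      ring
    · simp
  · intro y _ hy
    simp [hy.symm]
  · simp

theorem sum_exchange {n : ℕ} (h : Fin n → ℝ) (z : Fin n) :
    ∑ p : Fin n × Fin n, (if (p.2 : ℕ) = (p.1 : ℕ) + 1 then (1 / 2 : ℝ) else 0)
        * (h (Equiv.swap p.1 p.2 z) - h z)
      = (∑ y : Fin n, if (y : ℕ) = z + 1 then (h y - h z) / 2 else 0)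
        + ∑ x : Fin n, if (z : ℕ) = x + 1 then (h x - h z) / 2 else 0 := by
  have split : ∀ x y : Fin n, (if (y : ℕ) = (x : ℕ) + 1 then (1 / 2 : ℝ) else 0)
        * (h (Equiv.swap x y z) - h z)
      = (if x = z then (if (y : ℕ) = z + 1 then (h y - h z) / 2 else 0) else 0)
        + if y = z then (if (z : ℕ) = x + 1 then (h x - h z) / 2 else 0) else 0 := by
    intro x y
    by_cases hyx : (y : ℕ) = x + 1
    · have hne : x ≠ y := fun e => by rw [e] at hyx; omega
      by_cases hx : x = z
      · subst hx
        simp [hyx, hne.symm]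
        ring
      · by_cases hy : y = z
        · subst hy
          simp [hyx, hne]
          ring
        · simp [hx, hy, Equiv.swap_apply_of_ne_of_ne (Ne.symm hx) (Ne.symm hy)]
    · rw [if_neg hyx, zero_mul]
      by_cases hx : x = z <;> by_cases hy : y = z
      · subst hx; subst hy; simp
      · subst hx; simp [hyx, hy]
      · subst hy; simp [hyx, hx]
      · simp [hx, hy]
  rw [Fintype.sum_prod_type]
  simp only [split, Finset.sum_add_distrib]
  congr 1
  · rw [Finset.sum_comm]
    simp
  · simp

theorem sum_bdssepWeight_mul_exitTime {N : ℕ} (α β : ℝ) (z : Fin (N - 1)) :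
    ∑ j, bdssepWeight N α β j * (bdssepWeightAfter (exitTime N) j z - exitTime N z) = -1 := by
  rw [Fintype.sum_sum_type, Fintype.sum_sum_type]
  simp only [bdssepWeight, bdssepWeightAfter]
  rw [sum_exchange, sum_refresh, sum_refresh, sum_ite_val_eq]
  have hz := z.2
  have right : (if hk : (z : ℕ) + 1 < N - 1 then (exitTime N ⟨z + 1, hk⟩ - exitTime N z) / 2 else 0)
      + (if (z : ℕ) = N - 2 then -(exitTime N z) / 2 else 0)
      = ((z + 2) * (N - 2 - z) - exitTime N z) / 2 := by
    by_cases hk : (z : ℕ) + 1 < N - 1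
    · rw [dif_pos hk, if_neg (by omega)]
      simp only [exitTime]
      push_cast
      ring
    · have e : (z : ℕ) = N - 2 := by omega
      have e' : (N : ℝ) = z + 2 := by
        have : N = z + 2 := by omega
        exact_mod_cast this
      rw [dif_neg hk, if_pos e, e']
      ring
  have left : (∑ x : Fin (N - 1), if (z : ℕ) = x + 1 then (exitTime N x - exitTime N z) / 2 else 0)
      + (if (z : ℕ) = 0 then -(exitTime N z) / 2 else 0)
      = (z * (N - z) - exitTime N z) / 2 := by
    by_cases h0 : (z : ℕ) = 0
    · simp [h0]
    · obtain ⟨k, hk⟩ := Nat.exists_eq_succ_of_ne_zero h0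
      have e : ∀ x : Fin (N - 1), ((z : ℕ) = x + 1) = ((x : ℕ) = k) := fun x => by
        rw [hk]; exact propext (by omega)
      have e' : (z : ℝ) = k + 1 := by exact_mod_cast hk
      simp only [e]
      rw [sum_ite_val_eq, dif_pos (by omega), if_neg h0, exitTime, e']
      simp only
      ring
  have : exitTime N z = (z + 1) * (N - 1 - z) := rfl
  linarith

end Moves

/-- Exponential decay of the total variation distance to equilibrium for the BDSSEP. -/
theorem bdssep_half_sum_abs_trans_sub_le {N : ℕ} {α β : ℝ} (hα : 0 ≤ α) (hα1 : α ≤ 1)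
    (hβ : 0 ≤ β) (hβ1 : β ≤ 1) (c : CTMC (Config N)) (hR : c.R = bdssepR N α β) {t : NNReal}
    (ht : 0 < t) (η : Config N) :
    (1 / 2) * ∑ ξ, |c.trans t η ξ - c.ν ξ|
      ≤ (N - 1 : ℕ) * (N / 2 * Real.exp (-(4 / (N : ℝ) ^ 2) * t)) := by
  have hgen : ∀ f σ, c.generator f σ
      = ∑ j, bdssepWeight N α β j * (f (bdssepMap j σ) - f σ) := fun f σ => by
    rw [CTMC.generator, hR, sum_bdssepR_mul]
  have hN : ∀ _ : Fin (N - 1), (2 : ℝ) ≤ N := fun x => by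
    have := cast_add_two_le x
    have : (0 : ℝ) ≤ (x : ℕ) := Nat.cast_nonneg _
    linarith
  have hw := bdssepWeight_nonneg N hα hα1 hβ hβ1
  set W := ∑ j, bdssepWeight N α β j with hW
  have hW0 : 0 ≤ W := Finset.sum_nonneg fun j _ => hw j
  have hdecay : ∀ x : Fin (N - 1),
      ∑ j, bdssepWeight N α β j * (bdssepWeightAfter (exitTime N) j x - exitTime N x)
        ≤ -(4 / (N : ℝ) ^ 2) * exitTime N x := by
    intro x
    have := hN x
    have h1 := mul_le_mul_of_nonneg_left (exitTime_le x)
      (show 0 ≤ 4 / (N : ℝ) ^ 2 by positivity)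
    have h2 : 4 / (N : ℝ) ^ 2 * ((N : ℝ) ^ 2 / 4) = 1 := by field_simp
    rw [sum_bdssepWeight_mul_exitTime]
    linarith
  refine (c.half_sum_abs_trans_sub_le (h := exitTime N)
    (K := Real.exp (-(4 / (N : ℝ) ^ 2) * t) * (2 / N)) t (fun f hf => ?_) η).trans ?_
  · refine c.coordLipschitz_semigroup (s₀ := 1 / (W + 1)) (fun x => ?_) (by positivity) ?_
      (by positivity) ?_ (fun σ => (hf σ).trans (by norm_num)) (by positivity) ht
    · linarith [hN x, sub_one_le_exitTime x]
    · intro s hs hss K g hK hg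
      simp only [hgen]
      refine hg.add_sum_moves hK hs hw ?_ (abs_bdssepMap_update_sub_le hg) hdecay
      rw [le_div_iff₀ (by positivity)] at hss
      linarith
    · intro σ x b
      have h2 := hN x
      have h3 := sub_one_le_exitTime x
      have h1 : 1 ≤ 2 / (N : ℝ) * exitTime N x := by
        rw [div_mul_eq_mul_div, le_div_iff₀ (by linarith)]
        linarith
      have := hf σ
      have := hf (Function.update σ x b)
      rw [abs_le] at *
      constructor <;> linarith
  · calc _ ≤ ∑ _x : Fin (N - 1), N / 2 * Real.exp (-(4 / (N : ℝ) ^ 2) * t) := by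
          refine Finset.sum_le_sum fun x _ => ?_
          have := hN x
          refine (mul_le_mul_of_nonneg_left (exitTime_le x) (by positivity)).trans (le_of_eq ?_)
          field_simp
          ring
      _ = _ := by simp

/-- The mixing time of the BDSSEP with boundary densities
`0 < α ≤ β < 1` satisfies `T^mix_N ≤ N³/2` for all `N`. -/
theorem bdssep_mixing_time_le
    (α β : ℝ) (hα : 0 < α) (hαβ : α ≤ β) (hβ : β < 1)
    (chain : ∀ N : ℕ, CTMC (Config N))
    (hR : ∀ N, (chain N).R = bdssepR N α β) :
    ∀ N : ℕ, (chain N).tmix ≤ (N : ℝ) ^ 3 / 2 := by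
  intro N
  have bound : ∀ t : ℝ, 0 < t → ∀ η,
      (1 / 2) * ∑ ξ, |(chain N).trans t.toNNReal η ξ - (chain N).ν ξ|
      ≤ (N - 1 : ℕ) * (N / 2 * Real.exp (-(4 / (N : ℝ) ^ 2) * t)) := by
    intro t ht η
    have := bdssep_half_sum_abs_trans_sub_le hα.le (by linarith) (by linarith) hβ.le (chain N)
      (hR N) (Real.toNNReal_pos.2 ht) η
    rwa [Real.coe_toNNReal t ht.le] at this
  rcases Nat.lt_or_ge N 2 with hN | hN
  · have h0 : N - 1 = 0 := by omega
    have hle : (chain N).tmix ≤ 0 := le_of_forall_pos_le_add fun t ht => by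
      rw [zero_add]
      refine (chain N).tmix_le ht fun η => (bound t ht η).trans ?_
      rw [h0]
      norm_num
    exact hle.trans (by positivity)
  · have hN' : (2 : ℝ) ≤ N := by exact_mod_cast hN
    have ht : (0 : ℝ) < (N : ℝ) ^ 3 / 2 := by positivity
    refine (chain N).tmix_le ht fun η => (bound _ ht η).trans ?_
    have e : -(4 / (N : ℝ) ^ 2) * ((N : ℝ) ^ 3 / 2) = -(2 * N) := by
      field_simp
      ring
    rw [e, Real.exp_neg]
    have hexp : 2 * (N : ℝ) ^ 2 ≤ Real.exp (2 * N) := by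
      have := Real.quadratic_le_exp_of_nonneg (show (0 : ℝ) ≤ 2 * N by positivity)
      nlinarith
    have hc : ((N - 1 : ℕ) : ℝ) ≤ N := by exact_mod_cast Nat.sub_le N 1
    calc _ ≤ (N : ℝ) * (N / 2 * (2 * (N : ℝ) ^ 2)⁻¹) := by gcongr
      _ = 1 / 4 := by
        field_simp
        norm_num
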